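/- Assume in addition that I is a prime ideal, that the Krull dimension of ℂ[x_0,…,x_M]/I equals n+1, and that the quotient ring ℂ[x_0,…,x_M]/(I + (r_1,…,r_n)) has Krull dimension at most 1. For each 𝐢 ∈ ℤ_{≥0}^n let Δ^𝐢 denote the eventual value of Δ^𝐢_N (which is independent of N once N − ‖𝐢‖ is sufficiently large), and set Δ_0 = min_{𝐢 ∈ ℤ_{≥0}^n} Δ^𝐢. Then for every index j ∈ {1,…,n}, lim_{N→∞} (n+1)!·(Σ_{𝐢 ∈ τ_N} Δ^𝐢_N · i_j)/N^{n+1} exists and equals Δ_0; that is, Σ_{𝐢 ∈ τ_N} Δ^𝐢_N i_j = Δ_0·N^{n+1}/(n+1)! + O(N^n). -/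

import Mathlib

open MvPolynomial

noncomputable section

/-- The degree-`d` homogeneous part `ℂ[x]_d` of `ℂ[x_0,…,x_M]`. -/
def homogPart (M d : ℕ) : Submodule ℂ (MvPolynomial (Fin (M + 1)) ℂ) :=
  homogeneousSubmodule (Fin (M + 1)) ℂ d

/-- `‖𝐢‖ = i_1 + ⋯ + i_n`. -/
def normI {n : ℕ} (i : Fin n → ℕ) : ℕ := ∑ j, i j

/-- `r^𝐢 = r_1^{i_1} ⋯ r_n^{i_n}`. -/
def rPow {M n : ℕ} (r : Fin n → MvPolynomial (Fin (M + 1)) ℂ) (i : Fin n → ℕ) :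
    MvPolynomial (Fin (M + 1)) ℂ := ∏ j, (r j) ^ (i j)

/-- The space `I^𝐢_N`: all `p ∈ ℂ[x]_{N-‖𝐢‖}` such that
`r^𝐢·p - Σ_{𝐞 >_lex 𝐢, ‖𝐞‖ ≤ N} r^𝐞·c 𝐞 ∈ I_N = I ∩ ℂ[x]_N` for suitable
`c 𝐞 ∈ ℂ[x]_{N-‖𝐞‖}`. -/
def IfilSet (M n : ℕ) (I : Ideal (MvPolynomial (Fin (M + 1)) ℂ))
    (r : Fin n → MvPolynomial (Fin (M + 1)) ℂ) (i : Fin n → ℕ) (N : ℕ) :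
    Set (MvPolynomial (Fin (M + 1)) ℂ) :=
  {p | p ∈ homogPart M (N - normI i) ∧
    ∃ (s : Finset (Fin n → ℕ)) (c : (Fin n → ℕ) → MvPolynomial (Fin (M + 1)) ℂ),
      (∀ e ∈ s, toLex i < toLex e ∧ normI e ≤ N ∧ c e ∈ homogPart M (N - normI e)) ∧
      (rPow r i * p - ∑ e ∈ s, rPow r e * c e ∈ I ∧
        rPow r i * p - ∑ e ∈ s, rPow r e * c e ∈ homogPart M N)}

/-- The ideal `I^𝐢` generated by `⋃_{N ≥ ‖𝐢‖} I^𝐢_N`. -/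
def Iideal (M n : ℕ) (I : Ideal (MvPolynomial (Fin (M + 1)) ℂ))
    (r : Fin n → MvPolynomial (Fin (M + 1)) ℂ) (i : Fin n → ℕ) :
    Ideal (MvPolynomial (Fin (M + 1)) ℂ) :=
  Ideal.span {p | ∃ N, normI i ≤ N ∧ p ∈ IfilSet M n I r i N}

/-- `Δ^𝐢_N = dim_ℂ (ℂ[x]_{N-‖𝐢‖} / I^𝐢_N)`. -/
def Delta (M n : ℕ) (I : Ideal (MvPolynomial (Fin (M + 1)) ℂ))
    (r : Fin n → MvPolynomial (Fin (M + 1)) ℂ) (i : Fin n → ℕ) (N : ℕ) : ℕ :=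
  Module.finrank ℂ
    (↥(homogPart M (N - normI i)) ⧸
      (Submodule.span ℂ (IfilSet M n I r i N)).comap (homogPart M (N - normI i)).subtype)

/-- `dim_ℂ (ℂ[x]_N / I_N)`, the Hilbert function of `I`. -/
def DeltaV (M : ℕ) (I : Ideal (MvPolynomial (Fin (M + 1)) ℂ)) (N : ℕ) : ℕ :=
  Module.finrank ℂ
    (↥(homogPart M N) ⧸ (I.restrictScalars ℂ).comap (homogPart M N).subtype)

/-- `τ_N = {𝐢 ∈ ℤ_{≥0}^n : ‖𝐢‖ ≤ N}` as a `Finset`. -/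
def tauN (n N : ℕ) : Finset (Fin n → ℕ) :=
  (Fintype.piFinset fun _ : Fin n => Finset.range (N + 1)).filter fun i => normI i ≤ N

/-- The ideal `I` is homogeneous: it contains every homogeneous component of its members. -/
def IsHomogeneousIdeal {M : ℕ} (I : Ideal (MvPolynomial (Fin (M + 1)) ℂ)) : Prop :=
  ∀ p ∈ I, ∀ d : ℕ, homogeneousComponent d p ∈ I

end

open Filter

open Finset in
theorem mem_tauN {n N : ℕ} {i : Fin n → ℕ} : i ∈ tauN n N ↔ normI i ≤ N := by
  simp only [tauN, mem_filter, Fintype.mem_piFinset, mem_range, and_iff_right_iff_imp]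
  intro h j
  have : i j ≤ normI i := single_le_sum (f := i) (fun _ _ => Nat.zero_le _) (mem_univ j)
  omega

theorem normI_add {n : ℕ} (i k : Fin n → ℕ) : normI (i + k) = normI i + normI k := by
  simp [normI, Finset.sum_add_distrib]

theorem card_tauN (n N : ℕ) : (tauN n N).card = (N + n).choose n := by
  induction n generalizing N with
  | zero =>
    rw [Nat.choose_zero_right, Finset.card_eq_one]
    refine ⟨0, Finset.ext fun i => ?_⟩
    simp [mem_tauN, normI, Subsingleton.elim i 0]
  | succ n ih =>
    have hfib : ∀ t ∈ Finset.range (N + 1),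
        ((tauN (n + 1) N).filter fun i => i 0 = t).card = (N - t + n).choose n := by
      intro t ht
      rw [Finset.mem_range] at ht
      rw [← ih]
      symm
      refine Finset.card_bij (fun i _ => Fin.cons t i) ?_ ?_ ?_
      · intro i hi
        simp only [mem_tauN, Finset.mem_filter, normI, Fin.sum_univ_succ, Fin.cons_zero,
          Fin.cons_succ, and_true] at hi ⊢
        omega
      · intro a _ b _ hab
        exact (Fin.cons_injective2 hab).2
      · intro b hb
        simp only [mem_tauN, Finset.mem_filter, normI, Fin.sum_univ_succ] at hb
        refine ⟨Fin.tail b, ?_, ?_⟩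
        · simp only [mem_tauN, normI, Fin.tail]
          omega
        · rw [← hb.2, Fin.cons_self_tail]
    rw [Finset.card_eq_sum_card_fiberwise (f := fun i => i 0) (t := Finset.range (N + 1)),
      Finset.sum_congr rfl hfib]
    · refine (Finset.sum_range_reflect (fun m => (m + n).choose n) (N + 1)).trans ?_
      rw [Nat.sum_range_add_choose]
      rfl
    · intro i hi
      have hi := mem_tauN.1 hi
      simp only [normI, Fin.sum_univ_succ] at hi
      simp only [Finset.coe_range, Set.mem_Iio]
      omega

theorem sum_tauN_apply (n N : ℕ) (j : Fin n) :
    ∑ i ∈ tauN n N, i j = (N + n).choose (n + 1) := by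
  have hcard : ∀ t ∈ Finset.range N,
      ((tauN n N).filter fun i => t < i j).card = (N - 1 - t + n).choose n := by
    intro t ht
    rw [Finset.mem_range] at ht
    rw [← card_tauN]
    symm
    have hs : normI (Pi.single j (t + 1)) = t + 1 := by simp [normI]
    refine Finset.card_bij (fun i _ => i + Pi.single j (t + 1)) ?_ ?_ ?_
    · intro i hi
      simp only [mem_tauN, Finset.mem_filter, normI_add, hs, Pi.add_apply, Pi.single_eq_same]
        at hi ⊢
      omega
    · intro a _ b _ hab
      exact add_right_cancel hab
    · intro b hb
      simp only [mem_tauN, Finset.mem_filter] at hb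
      have hle : Pi.single j (t + 1) ≤ b := by
        intro k
        rcases eq_or_ne k j with rfl | hk
        · simpa using hb.2
        · simp [hk]
      refine ⟨b - Pi.single j (t + 1), ?_, tsub_add_cancel_of_le hle⟩
      have := normI_add (b - Pi.single j (t + 1)) (Pi.single j (t + 1))
      rw [tsub_add_cancel_of_le hle] at this
      rw [mem_tauN]
      omega
  have hcount : ∀ i ∈ tauN n N, i j = ∑ t ∈ Finset.range N, if t < i j then 1 else 0 := by
    intro i hi
    have h1 : i j ≤ normI i :=
      Finset.single_le_sum (f := i) (fun _ _ => Nat.zero_le _) (Finset.mem_univ j)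
    have h2 := mem_tauN.1 hi
    rw [← Finset.card_filter]
    have : (Finset.range N).filter (fun t => t < i j) = Finset.range (i j) := by
      ext t
      simp only [Finset.mem_filter, Finset.mem_range]
      omega
    rw [this, Finset.card_range]
  rw [Finset.sum_congr rfl hcount, Finset.sum_comm]
  simp_rw [← Finset.card_filter]
  rw [Finset.sum_congr rfl hcard, Finset.sum_range_reflect (fun m => (m + n).choose n) N]
  cases N with
  | zero => simp
  | succ N => rw [Nat.sum_range_add_choose]; congr 1; ring

theorem tendsto_factorial_mul_sum_tauN (n K : ℕ) (j : Fin n) :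
    Tendsto (fun N : ℕ => ((n + 1).factorial : ℝ) * ((∑ i ∈ tauN n (N - K), i j : ℕ) : ℝ) /
      (N : ℝ) ^ (n + 1)) atTop (nhds 1) := by
  have hS : ∀ N, (n + 1).factorial * ∑ i ∈ tauN n N, i j = N.ascFactorial (n + 1) := by
    intro N
    rw [sum_tauN_apply, Nat.ascFactorial_eq_factorial_mul_choose']
    rfl
  have hlow : Tendsto (fun N : ℕ => (1 - (K : ℝ) / N) ^ (n + 1)) atTop (nhds 1) := by
    simpa using ((tendsto_const_div_atTop_nhds_zero_nat (K : ℝ)).const_sub 1).pow (n + 1)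
  have hupp : Tendsto (fun N : ℕ => (1 + ((n + 1 : ℕ) : ℝ) / N) ^ (n + 1)) atTop (nhds 1) := by
    simpa using ((tendsto_const_div_atTop_nhds_zero_nat ((n + 1 : ℕ) : ℝ)).const_add 1).pow (n + 1)
  refine tendsto_of_tendsto_of_tendsto_of_le_of_le' hlow hupp ?_ ?_
  · filter_upwards [eventually_ge_atTop (K + 1)] with N hN
    have hN0 : (0 : ℝ) < N := by exact_mod_cast (by omega : 0 < N)
    rw [← Nat.cast_mul, hS, one_sub_div hN0.ne', div_pow, ← Nat.cast_sub (by omega)]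
    gcongr
    exact_mod_cast Nat.pow_succ_le_ascFactorial _ _
  · filter_upwards [eventually_ge_atTop (K + 1)] with N hN
    have hN0 : (0 : ℝ) < N := by exact_mod_cast (by omega : 0 < N)
    rw [← Nat.cast_mul, hS, one_add_div hN0.ne', div_pow]
    gcongr
    exact_mod_cast (Nat.ascFactorial_le (n + 1) (by omega : N - K ≤ N + 1)).trans
      (Nat.ascFactorial_le_pow_add N (n + 1))

/-- A uniformly bounded weight on the sets `τ_N` that is constant on a translated orthant, away
from the face `‖i‖ = N`, has the weighted first moments of a constant weight. -/
theorem tendsto_weighted_sum_tauN {n : ℕ} (h : (Fin n → ℕ) → ℕ → ℕ) (C K v : ℕ)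
    (i₀ : Fin n → ℕ) (hC : ∀ i d, h i d ≤ C) (hv : ∀ i d, i₀ ≤ i → K < d → h i d = v)
    (j : Fin n) :
    Tendsto (fun N : ℕ => ((n + 1).factorial : ℝ) *
      ((∑ i ∈ tauN n N, h i (N - normI i) * i j : ℕ) : ℝ) / (N : ℝ) ^ (n + 1))
      atTop (nhds (v : ℝ)) := by
  set L := K + 1 + normI i₀ with hL
  have hbounds : ∀ N, L ≤ N →
      v * ∑ i ∈ tauN n (N - L), i j ≤ ∑ i ∈ tauN n N, h i (N - normI i) * i j ∧
      ∑ i ∈ tauN n N, h i (N - normI i) * i j + C * ∑ i ∈ tauN n (N - L), i j ≤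
        v * ∑ i ∈ tauN n N, i j + C * ∑ i ∈ tauN n N, i j := by
    intro N hN
    set G := (tauN n (N - L)).map (addRightEmbedding i₀) with hG
    have hnorm : ∀ i ∈ G, i₀ ≤ i ∧ normI i + K < N := by
      intro i hi
      obtain ⟨k, hk, rfl⟩ := Finset.mem_map.1 hi
      rw [mem_tauN] at hk
      simp only [addRightEmbedding_apply, normI_add]
      exact ⟨le_add_self, by omega⟩
    have hsub : G ⊆ tauN n N := fun i hi => mem_tauN.2 (by have := (hnorm i hi).2; omega)
    have hGv : ∑ i ∈ G, h i (N - normI i) * i j = v * ∑ i ∈ G, i j := by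
      rw [Finset.mul_sum]
      refine Finset.sum_congr rfl fun i hi => ?_
      rw [hv i _ (hnorm i hi).1 (by have := (hnorm i hi).2; omega)]
    have hGlow : ∑ i ∈ tauN n (N - L), i j ≤ ∑ i ∈ G, i j := by
      rw [hG, Finset.sum_map]
      exact Finset.sum_le_sum fun i _ => by simp
    have hrest : ∑ i ∈ tauN n N \ G, h i (N - normI i) * i j ≤ C * ∑ i ∈ tauN n N \ G, i j := by
      rw [Finset.mul_sum]
      exact Finset.sum_le_sum fun i _ => Nat.mul_le_mul_right _ (hC _ _)
    have e1 := Finset.sum_sdiff (f := fun i => h i (N - normI i) * i j) hsub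
    have e2 := Finset.sum_sdiff (f := fun i => i j) hsub
    constructor
    · rw [← e1, hGv]
      exact (Nat.mul_le_mul_left v hGlow).trans (Nat.le_add_left _ _)
    · rw [← e1, ← e2]
      nlinarith [Nat.mul_le_mul_left C hGlow, Nat.zero_le (v * ∑ i ∈ tauN n N \ G, i j)]
  have t0 := tendsto_factorial_mul_sum_tauN n 0 j
  have tL := tendsto_factorial_mul_sum_tauN n L j
  have hlow := tL.const_mul (v : ℝ)
  have hupp := (t0.const_mul (v : ℝ)).add ((t0.sub tL).const_mul (C : ℝ))
  simp only [mul_one, sub_self, mul_zero, add_zero] at hlow hupp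
  refine tendsto_of_tendsto_of_tendsto_of_le_of_le' hlow hupp ?_ ?_
  · filter_upwards [eventually_ge_atTop L] with N hN
    have h1 : (v : ℝ) * ((∑ i ∈ tauN n (N - L), i j : ℕ) : ℝ) ≤
      ((∑ i ∈ tauN n N, h i (N - normI i) * i j : ℕ) : ℝ) := by exact_mod_cast (hbounds N hN).1
    rw [← mul_div_assoc, mul_left_comm]
    gcongr
  · filter_upwards [eventually_ge_atTop L] with N hN
    have h2 : ((∑ i ∈ tauN n N, h i (N - normI i) * i j : ℕ) : ℝ) +
        C * ((∑ i ∈ tauN n (N - L), i j : ℕ) : ℝ) ≤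
        v * ((∑ i ∈ tauN n N, i j : ℕ) : ℝ) + C * ((∑ i ∈ tauN n N, i j : ℕ) : ℝ) := by
      exact_mod_cast (hbounds N hN).2
    rw [Nat.sub_zero, ← sub_div, ← mul_div_assoc, ← mul_div_assoc, ← add_div]
    gcongr
    nlinarith [Nat.cast_nonneg (α := ℝ) (n + 1).factorial]

/-- A monotone map from a well-quasi-order to a partial order with the ascending chain condition
has finite range. -/
theorem Monotone.finite_range_of_wellQuasiOrderedLE {α β : Type*} [Preorder α]
    [WellQuasiOrderedLE α] [PartialOrder β] [WellFoundedGT β] {f : α → β} (hf : Monotone f) :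
    (Set.range f).Finite := by
  by_contra hinf
  have hinf : (Set.range f).Infinite := hinf
  let e := hinf.natEmbedding
  choose g hg using fun m => (e m).2
  obtain ⟨φ, hφ⟩ := (wellQuasiOrdered_le (α := α)).exists_monotone_subseq g
  have hmono : Monotone fun m => f (g (φ m)) := fun a b hab => hf (hφ a b hab)
  obtain ⟨m, hm⟩ := WellFoundedGT.monotone_chain_condition ⟨_, hmono⟩
  have heq : f (g (φ m)) = f (g (φ (m + 1))) := hm (m + 1) (by omega)
  rw [hg, hg] at heq
  have := φ.injective (e.injective (Subtype.ext heq))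
  omega

section Filtration

variable {M n : ℕ} {I : Ideal (MvPolynomial (Fin (M + 1)) ℂ)}
  {r : Fin n → MvPolynomial (Fin (M + 1)) ℂ}

theorem mul_mem_homogPart {a b d : ℕ} {p q : MvPolynomial (Fin (M + 1)) ℂ}
    (hp : p ∈ homogPart M a) (hq : q ∈ homogPart M b) (h : a + b = d) :
    p * q ∈ homogPart M d :=
  h ▸ MvPolynomial.IsHomogeneous.mul hp hq

theorem rPow_add (i k : Fin n → ℕ) : rPow r (i + k) = rPow r i * rPow r k := by
  simp [rPow, pow_add, Finset.prod_mul_distrib]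

theorem rPow_mem_homogPart (hr : ∀ j, r j ∈ homogPart M 1) (i : Fin n → ℕ) :
    rPow r i ∈ homogPart M (normI i) := by
  refine MvPolynomial.IsHomogeneous.prod _ _ _ fun j _ => ?_
  simpa using MvPolynomial.IsHomogeneous.pow (hr j) (i j)

theorem mul_mem_IfilSet {i : Fin n → ℕ} {N t : ℕ} {p q : MvPolynomial (Fin (M + 1)) ℂ}
    (hi : normI i ≤ N) (hp : p ∈ IfilSet M n I r i N) (hq : q ∈ homogPart M t) :
    q * p ∈ IfilSet M n I r i (N + t) := by
  obtain ⟨hp1, s, c, hs, hmem, hhom⟩ := hp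
  have key : rPow r i * (q * p) - ∑ e ∈ s, rPow r e * (q * c e) =
      q * (rPow r i * p - ∑ e ∈ s, rPow r e * c e) := by
    rw [mul_sub, Finset.mul_sum]
    congr 1
    · ring
    · exact Finset.sum_congr rfl fun _ _ => by ring
  refine ⟨mul_mem_homogPart hq hp1 (by omega), s, fun e => q * c e, fun e he => ?_, ?_, ?_⟩
  · obtain ⟨h1, h2, h3⟩ := hs e he
    exact ⟨h1, by omega, mul_mem_homogPart hq h3 (by omega)⟩
  · rw [key]
    exact I.mul_mem_left _ hmem
  · rw [key]
    exact mul_mem_homogPart hq hhom (by omega)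

theorem IfilSet_subset_add (hr : ∀ j, r j ∈ homogPart M 1) {i : Fin n → ℕ} {N : ℕ}
    (k : Fin n → ℕ) :
    IfilSet M n I r i N ⊆ IfilSet M n I r (i + k) (N + normI k) := by
  rintro p ⟨hp1, s, c, hs, hmem, hhom⟩
  have key : rPow r (i + k) * p -
      ∑ e ∈ s.map (addRightEmbedding k), rPow r e * c (e - k) =
      rPow r k * (rPow r i * p - ∑ e ∈ s, rPow r e * c e) := by
    rw [Finset.sum_map, mul_sub, Finset.mul_sum]
    congr 1
    · rw [rPow_add]; ring
    · refine Finset.sum_congr rfl fun e _ => ?_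
      rw [addRightEmbedding_apply, rPow_add, add_tsub_cancel_right]
      ring
  refine ⟨?_, s.map (addRightEmbedding k), fun e => c (e - k), fun e he => ?_, ?_, ?_⟩
  · rwa [normI_add, Nat.add_sub_add_right]
  · obtain ⟨e, he', rfl⟩ := Finset.mem_map.1 he
    obtain ⟨h1, h2, h3⟩ := hs e he'
    simp only [addRightEmbedding_apply, add_tsub_cancel_right, normI_add, toLex_add,
      Nat.add_sub_add_right]
    exact ⟨add_lt_add_left h1 _, by omega, h3⟩
  · rw [key]
    exact I.mul_mem_left _ hmem
  · rw [key]
    exact mul_mem_homogPart (rPow_mem_homogPart hr k) hhom (by omega)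

theorem IfilSet_subset_of_le (hr : ∀ j, r j ∈ homogPart M 1) {i i' : Fin n → ℕ} (h : i ≤ i')
    (d : ℕ) : IfilSet M n I r i (d + normI i) ⊆ IfilSet M n I r i' (d + normI i') := by
  have := IfilSet_subset_add (I := I) hr (i := i) (N := d + normI i) (i' - i)
  rwa [add_assoc, ← normI_add, add_tsub_cancel_of_le h] at this

theorem Iideal_mono (hr : ∀ j, r j ∈ homogPart M 1) : Monotone (Iideal M n I r) := by
  intro i i' h
  refine Ideal.span_mono ?_
  rintro p ⟨N, hN, hp⟩
  obtain ⟨d, rfl⟩ := Nat.exists_eq_add_of_le' hN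
  exact ⟨d + normI i', Nat.le_add_left _ _, IfilSet_subset_of_le hr h d hp⟩

theorem homogeneousComponent_mem_span_IfilSet {i : Fin n → ℕ}
    {p : MvPolynomial (Fin (M + 1)) ℂ} (hp : p ∈ Iideal M n I r i) (d : ℕ) :
    homogeneousComponent d p ∈ Submodule.span ℂ (IfilSet M n I r i (d + normI i)) := by
  induction hp using Submodule.closure_induction with
  | zero => simp
  | add x y _ _ hx hy => rw [map_add]; exact add_mem hx hy
  | smul_mem q x hx =>
    obtain ⟨N, hN, hx⟩ := hx
    rw [smul_eq_mul, ← sum_homogeneousComponent q, Finset.sum_mul, map_sum]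
    refine Submodule.sum_mem _ fun t _ => ?_
    have hmem := mul_mem_IfilSet hN hx (homogeneousComponent_mem t q)
    rw [homogeneousComponent_of_mem hmem.1]
    split_ifs with hd
    · rw [hd, Nat.sub_add_cancel (by omega)]
      exact Submodule.subset_span hmem
    · exact zero_mem _

theorem mem_span_IfilSet_iff {i : Fin n → ℕ} {d : ℕ} {p : MvPolynomial (Fin (M + 1)) ℂ}
    (hp : p ∈ homogPart M d) :
    p ∈ Submodule.span ℂ (IfilSet M n I r i (d + normI i)) ↔ p ∈ Iideal M n I r i := by
  constructor
  · intro h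
    have hle : Submodule.span ℂ (IfilSet M n I r i (d + normI i)) ≤
        (Iideal M n I r i).restrictScalars ℂ :=
      Submodule.span_le.2 fun q hq => Ideal.subset_span ⟨_, Nat.le_add_left _ _, hq⟩
    exact hle h
  · intro h
    have := homogeneousComponent_mem_span_IfilSet h d
    rwa [homogeneousComponent_of_mem hp, if_pos rfl] at this

theorem Delta_add_normI (i : Fin n → ℕ) (d : ℕ) :
    Delta M n I r i (d + normI i) = DeltaV M (Iideal M n I r i) d := by
  have heq : (Submodule.span ℂ (IfilSet M n I r i (d + normI i))).comap
      (homogPart M d).subtype =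
      ((Iideal M n I r i).restrictScalars ℂ).comap (homogPart M d).subtype :=
    Submodule.ext fun p => mem_span_IfilSet_iff p.2
  rw [Delta, Nat.add_sub_cancel, DeltaV, heq]

instance finite_homogPart (M d : ℕ) : Module.Finite ℂ (homogPart M d) :=
  Module.Finite.iff_fg.2 (homogeneousSubmodule_fg (Fin (M + 1)) ℂ d)

theorem DeltaV_anti {J J' : Ideal (MvPolynomial (Fin (M + 1)) ℂ)} (h : J ≤ J') (d : ℕ) :
    DeltaV M J' d ≤ DeltaV M J d := by
  have hle : (J.restrictScalars ℂ).comap (homogPart M d).subtype ≤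
      (J'.restrictScalars ℂ).comap (homogPart M d).subtype := fun p hp => h hp
  exact LinearMap.finrank_le_finrank_of_surjective (Submodule.factor_surjective hle)

end Filtration

/-- With `I` prime of Krull dimension `n+1` and `dim ℂ[x]/(I+(r_1,…,r_n)) ≤ 1`, for each
index `j` one has `Σ_{𝐢 ∈ τ_N} Δ^𝐢_N·i_j = Δ_0·N^{n+1}/(n+1)! + O(N^n)`, i.e.
`lim_{N→∞} (n+1)!·(Σ_{𝐢 ∈ τ_N} Δ^𝐢_N·i_j)/N^{n+1} = Δ_0`. -/
theorem sum_Delta_mul_tendsto (M n : ℕ) (hM : 1 ≤ M) (hn : 1 ≤ n)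
    (I : Ideal (MvPolynomial (Fin (M + 1)) ℂ)) (hI : IsHomogeneousIdeal I)
    (hprime : I.IsPrime)
    (hdimI : ringKrullDim (MvPolynomial (Fin (M + 1)) ℂ ⧸ I) = (n + 1 : ℕ))
    (r : Fin n → MvPolynomial (Fin (M + 1)) ℂ)
    (hr : ∀ j, r j ≠ 0 ∧ r j ∈ homogPart M 1)
    (hdim : ringKrullDim
      (MvPolynomial (Fin (M + 1)) ℂ ⧸ (I ⊔ Ideal.span (Set.range r))) ≤ 1)
    (D : (Fin n → ℕ) → ℕ)
    (hD : ∀ i : Fin n → ℕ, ∃ N₁ : ℕ, ∀ N : ℕ, N₁ + normI i < N → Delta M n I r i N = D i)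
    (Δ₀ : ℕ) (hΔ₀ : IsLeast (Set.range D) Δ₀) (j : Fin n) :
    Tendsto
      (fun N : ℕ =>
        ((n + 1).factorial : ℝ) * ((∑ i ∈ tauN n N, Delta M n I r i N * i j : ℕ) : ℝ) /
          (N : ℝ) ^ (n + 1))
      atTop (nhds (Δ₀ : ℝ)) := by
  have hr1 : ∀ j, r j ∈ homogPart M 1 := fun j => (hr j).2
  set J := Iideal M n I r with hJ
  have hmono : Monotone J := Iideal_mono hr1
  choose B hB using hD
  have hBD : ∀ i d, B i < d → DeltaV M (J i) d = D i := fun i d h => by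
    rw [← Delta_add_normI]
    exact hB i _ (by omega)
  obtain ⟨⟨i₀, hi₀⟩, hmin⟩ := hΔ₀
  obtain ⟨K₁, hK₁⟩ : ∃ K, ∀ i d, K < d → Δ₀ ≤ DeltaV M (J i) d := by
    have hfin := hmono.finite_range_of_wellQuasiOrderedLE
    choose! rep hrep using fun (x : Ideal (MvPolynomial (Fin (M + 1)) ℂ)) (hx : x ∈ Set.range J) =>
      hx
    obtain ⟨K, hK⟩ := (hfin.image fun x => B (rep x)).bddAbove
    refine ⟨K, fun i d hd => ?_⟩
    have hle : B (rep (J i)) ≤ K := hK ⟨J i, ⟨i, rfl⟩, rfl⟩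
    rw [← hrep (J i) ⟨i, rfl⟩, hBD _ _ (hle.trans_lt hd)]
    exact hmin ⟨_, rfl⟩
  obtain ⟨C, hC⟩ : ∃ C, ∀ d, DeltaV M (J 0) d ≤ C := by
    refine ⟨D 0 + ∑ d ∈ Finset.range (B 0 + 1), DeltaV M (J 0) d, fun d => ?_⟩
    rcases lt_or_ge (B 0) d with h | h
    · rw [hBD 0 d h]
      exact Nat.le_add_right _ _
    · exact (Finset.single_le_sum (f := DeltaV M (J 0)) (fun _ _ => Nat.zero_le _)
        (Finset.mem_range.2 (by omega : d < B 0 + 1))).trans (Nat.le_add_left _ _)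
  have hsum : ∀ N, ∑ i ∈ tauN n N, Delta M n I r i N * i j =
      ∑ i ∈ tauN n N, DeltaV M (J i) (N - normI i) * i j := fun N =>
    Finset.sum_congr rfl fun i hi => by
      rw [← Delta_add_normI, Nat.sub_add_cancel (mem_tauN.1 hi)]
  simp_rw [hsum]
  refine tendsto_weighted_sum_tauN (fun i => DeltaV M (J i)) C (max K₁ (B i₀)) Δ₀ i₀
    (fun i d => (DeltaV_anti (hmono fun _ => Nat.zero_le _) d).trans (hC d)) (fun i d hi hd => ?_) j
  refine le_antisymm ?_ (hK₁ i d (by omega))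
  rw [← hi₀, ← hBD i₀ d (by omega)]
  exact DeltaV_anti (hmono hi) d
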